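/- Let S be a set of dominant rational self-maps of projective N-space over the algebraic closure of Q, let ν be a probability measure on S, and let (Φ_S, ν̄) be the space of i.i.d. sequences of elements of S distributed according to ν. If the expectation E_1[log deg(φ)] of log deg over a single draw from (S, ν) exists (is finite), then there is a constant δ_{S,ν} := exp( inf_{n≥1} E_n[log deg(γ_n)] / n ) such that for ν̄-almost every sequence γ ∈ Φ_S, the limit lim_{n→∞} deg(γ_n)^{1/n} exists and equals δ_{S,ν}. -/

import Mathlib

/-!
Statement 0 (Theorem `dyndeg`, random dynamical degrees via Kingman).

We model the monoid `Dom(ℙ^N(ℚ̄))` of dominant rational self-maps of projective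
`N`-space over `ℚ̄` abstractly: a monoid `M` (composition) together with a degree
function `deg : M → ℕ` which satisfies the standard facts for dominant rational
self-maps of `ℙ^N`: `deg ≥ 1`, `deg (id) = 1`, and submultiplicativity
`deg (f ∘ g) ≤ deg f * deg g`.

The set `S` of maps is given by `F : S → M`; `S` is finite or countable and all
its subsets are measurable.  The space `Φ_S` of i.i.d. sequences is `ℕ → S`
(the sequence `γ = (θ_1, θ_2, …)` with `θ_{i+1} = γ i`), equipped with a
probability measure `μ = ν̄` which is the product of the copies of `ν`,
characterized by its values on cylinder sets.

`seqComp F γ n` is `γ_n = θ_n ∘ ⋯ ∘ θ_1`.  Since `log deg (γ_n)` only depends on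
the first `n` coordinates, the expectation `E_n[log deg γ_n]` over `S^n` equals
the integral over `ν̄`.
-/

open MeasureTheory Filter

/-- `γ_n = θ_n ∘ θ_{n-1} ∘ ⋯ ∘ θ_1` for the sequence `γ = (θ_1, θ_2, …)`,
`θ_{i+1} = γ i`; by convention `γ_0 = id`. -/
def seqComp {S M : Type*} [Monoid M] (F : S → M) (γ : ℕ → S) : ℕ → M
  | 0 => 1
  | n + 1 => F (γ n) * seqComp F γ n

section Kingman

open scoped ENNReal

variable {Ω : Type*} {T : Ω → Ω} {g : ℕ → Ω → ℝ≥0∞}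

theorem liminf_div_le_liminf_div_comp
    (hsub : ∀ m n x, g (m + n) x ≤ g m x + g n (T^[m] x)) (hfin : ∀ x, g 1 x ≠ ∞) (x : Ω) :
    liminf (fun n => g n x / n) atTop ≤ liminf (fun n => g n (T x) / n) atTop := by
  refine le_of_forall_gt_imp_ge_of_dense fun a ha => ?_
  obtain ⟨b, hb, hba⟩ := exists_between ha
  have hfreq : ∃ᶠ n : ℕ in atTop, g n (T x) / n < b :=
    frequently_lt_of_liminf_lt (by isBoundedDefault) hb
  have hlim : Tendsto (fun n : ℕ => g 1 x / ((n + 1 : ℕ) : ℝ≥0∞)) atTop (nhds 0) := by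
    have := ENNReal.Tendsto.const_div (a := g 1 x) ENNReal.tendsto_nat_nhds_top
      (Or.inr (hfin x))
    rw [ENNReal.div_top] at this
    exact (tendsto_add_atTop_iff_nat 1).2 this
  have hev := hlim.eventually_lt_const (tsub_pos_of_lt hba)
  rw [← liminf_nat_add _ 1]
  refine liminf_le_of_frequently_le'
    ((hfreq.and_eventually (hev.and (eventually_ge_atTop 1))).mono ?_)
  rintro n ⟨h1, h2, h3⟩
  have hsub' : g (n + 1) x ≤ g 1 x + g n (T x) := by
    rw [add_comm n 1]; exact hsub 1 n x
  calc g (n + 1) x / ((n + 1 : ℕ) : ℝ≥0∞)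
      ≤ (g 1 x + g n (T x)) / ((n + 1 : ℕ) : ℝ≥0∞) := by gcongr
    _ = g 1 x / ((n + 1 : ℕ) : ℝ≥0∞) + g n (T x) / ((n + 1 : ℕ) : ℝ≥0∞) := ENNReal.add_div
    _ ≤ (a - b) + b := by
        gcongr
        refine le_trans ?_ h1.le
        gcongr
        simp
    _ = a := tsub_add_cancel_of_le hba.le

theorem apply_le_sum_of_exists_apply_le {φ : Ω → ℝ≥0∞} {N : ℕ}
    (hsub : ∀ m n x, g (m + n) x ≤ g m x + g n (T^[m] x)) (h0 : ∀ x, g 0 x = 0)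
    (hφ : ∀ x, ∃ n, 1 ≤ n ∧ n ≤ N ∧ g n x ≤ ∑ i ∈ Finset.range n, φ (T^[i] x)) (K : ℕ) (x : Ω) :
    g K x ≤ ∑ i ∈ Finset.range K,
      (φ (T^[i] x) + if K ≤ i + N then g 1 (T^[i] x) else 0) := by
  induction K using Nat.strong_induction_on generalizing x with
  | _ K ih =>
    have step : ∀ n, 1 ≤ n → n ≤ K → g n x ≤ ∑ i ∈ Finset.range n,
        (φ (T^[i] x) + if K ≤ i + N then g 1 (T^[i] x) else 0) →
        g K x ≤ ∑ i ∈ Finset.range K,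
          (φ (T^[i] x) + if K ≤ i + N then g 1 (T^[i] x) else 0) := by
      intro n hn hnK hg
      obtain ⟨k, rfl⟩ := Nat.exists_eq_add_of_le hnK
      rw [Finset.sum_range_add]
      refine (hsub n k x).trans (add_le_add hg ((ih k (by omega) (T^[n] x)).trans_eq ?_))
      refine Finset.sum_congr rfl fun i _ => ?_
      rw [← Function.iterate_add_apply, add_comm i n]
      congr 2
      exact propext ⟨fun h => by omega, fun h => by omega⟩
    rcases Nat.eq_zero_or_pos K with rfl | hK
    · simp [h0]
    by_cases hKN : K ≤ N
    · refine step 1 le_rfl hK ?_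
      simp [hKN]
    · obtain ⟨n, hn, hnN, hg⟩ := hφ x
      refine step n hn (by omega) (hg.trans ?_)
      gcongr
      exact le_self_add

variable [MeasurableSpace Ω] {μ : Measure Ω}

theorem lintegral_apply_le (hT : MeasurePreserving T μ μ) {φ : Ω → ℝ≥0∞} {N : ℕ}
    (hg : ∀ n, Measurable (g n)) (hφm : Measurable φ)
    (hsub : ∀ m n x, g (m + n) x ≤ g m x + g n (T^[m] x)) (h0 : ∀ x, g 0 x = 0)
    (hφ : ∀ x, ∃ n, 1 ≤ n ∧ n ≤ N ∧ g n x ≤ ∑ i ∈ Finset.range n, φ (T^[i] x)) (K : ℕ) :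
    ∫⁻ x, g K x ∂μ ≤ K * ∫⁻ x, φ x ∂μ + N * ∫⁻ x, g 1 x ∂μ := by
  have hite : ∀ i, Measurable fun x => if K ≤ i + N then g 1 (T^[i] x) else 0 := fun i => by
    split_ifs
    · exact (hg 1).comp (hT.iterate i).measurable
    · exact measurable_const
  have hφi : ∀ i, Measurable fun x => φ (T^[i] x) :=
    fun i => hφm.comp (hT.iterate i).measurable
  have hcard : ((Finset.range K).filter fun i => K ≤ i + N).card ≤ N := by
    calc _ ≤ (Finset.Ico (K - N) K).card := Finset.card_le_card fun i hi => by
            simp only [Finset.mem_filter, Finset.mem_range, Finset.mem_Ico] at hi ⊢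
            omega
      _ ≤ N := by rw [Nat.card_Ico]; omega
  calc ∫⁻ x, g K x ∂μ
      ≤ ∫⁻ x, ∑ i ∈ Finset.range K,
          (φ (T^[i] x) + if K ≤ i + N then g 1 (T^[i] x) else 0) ∂μ :=
        lintegral_mono (apply_le_sum_of_exists_apply_le hsub h0 hφ K)
    _ = ∑ i ∈ Finset.range K, (∫⁻ x, φ x ∂μ + if K ≤ i + N then ∫⁻ x, g 1 x ∂μ else 0) := by
        rw [lintegral_finsetSum _ fun i _ => by exact (hφi i).add (hite i)]
        refine Finset.sum_congr rfl fun i _ => ?_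
        rw [lintegral_add_left (hφi i), (hT.iterate i).lintegral_comp hφm]
        split_ifs
        · rw [(hT.iterate i).lintegral_comp (hg 1)]
        · simp
    _ ≤ K * ∫⁻ x, φ x ∂μ + N * ∫⁻ x, g 1 x ∂μ := by
        rw [Finset.sum_add_distrib, ← Finset.sum_filter]
        simp only [Finset.sum_const, Finset.card_range, nsmul_eq_mul]
        gcongr

theorem le_of_forall_natCast_mul_le {a b c : ℝ≥0∞} (hb : b ≠ ∞)
    (h : ∀ K : ℕ, K * c ≤ K * a + b) : c ≤ a := by
  have hlim : Tendsto (fun K : ℕ => a + b / K) atTop (nhds (a + 0)) := by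
    have := ENNReal.Tendsto.const_div (a := b) ENNReal.tendsto_nat_nhds_top (Or.inr hb)
    rw [ENNReal.div_top] at this
    exact tendsto_const_nhds.add this
  rw [add_zero] at hlim
  refine ge_of_tendsto hlim ((eventually_ge_atTop 1).mono fun K hK => ?_)
  have hK0 : (K : ℝ≥0∞) ≠ 0 := by simpa using (by omega : K ≠ 0)
  have hKt : (K : ℝ≥0∞) ≠ ∞ := ENNReal.natCast_ne_top K
  rw [← ENNReal.mul_le_mul_iff_right hK0 hKt, mul_add, ENNReal.mul_div_cancel hK0 hKt]
  exact h K

/-- The lower bound in Kingman's subadditive ergodic theorem, for a nonnegative cocycle. -/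
theorem le_lintegral_liminf_div [IsProbabilityMeasure μ] (hT : MeasurePreserving T μ μ)
    (hg : ∀ n, Measurable (g n))
    (hsub : ∀ m n x, g (m + n) x ≤ g m x + g n (T^[m] x)) (h0 : ∀ x, g 0 x = 0)
    (hfin : ∀ x, g 1 x ≠ ∞) (hint : ∫⁻ x, g 1 x ∂μ ≠ ∞) {c : ℝ≥0∞}
    (hc : ∀ K : ℕ, K * c ≤ ∫⁻ x, g K x ∂μ) :
    c ≤ ∫⁻ x, liminf (fun n => g n x / n) atTop ∂μ := by
  set h : Ω → ℝ≥0∞ := fun x => liminf (fun n => g n x / n) atTop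
  have hm : Measurable h := Measurable.liminf fun n => (hg n).div_const _
  have hmono : ∀ i x, h x ≤ h (T^[i] x) := by
    intro i x
    induction i with
    | zero => rfl
    | succ i ih =>
      rw [Function.iterate_succ_apply']
      exact ih.trans (liminf_div_le_liminf_div_comp hsub hfin _)
  refine le_of_forall_gt_imp_ge_of_dense fun a ha => ?_
  obtain ⟨ε, hε, hεa⟩ : ∃ ε : ℝ≥0∞, 0 < ε ∧ ∫⁻ x, h x ∂μ + ε ≤ a :=
    ⟨a - ∫⁻ x, h x ∂μ, tsub_pos_of_lt ha, (add_tsub_cancel_of_le ha.le).le⟩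
  refine le_trans ?_ hεa
  let B : ℕ → Set Ω := fun N => {x | ∀ n, 1 ≤ n → n ≤ N → (n : ℝ≥0∞) * (h x + ε) < g n x}
  have hBm : ∀ N, MeasurableSet (B N) := fun N => by
    have : B N = ⋂ n, ⋂ (_ : 1 ≤ n), ⋂ (_ : n ≤ N), {x | (n : ℝ≥0∞) * (h x + ε) < g n x} := by
      ext x; simp [B]
    rw [this]
    exact MeasurableSet.iInter fun n => MeasurableSet.iInter fun _ => MeasurableSet.iInter fun _ =>
      measurableSet_lt ((hm.add_const _).const_mul _) (hg n)
  have hBanti : Antitone B := fun N M hNM x hx n h1 h2 => hx n h1 (h2.trans hNM)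
  have hBempty : ⋂ N, B N = ∅ := by
    refine Set.eq_empty_of_forall_notMem fun x hx => ?_
    have hx : ∀ n : ℕ, 1 ≤ n → (n : ℝ≥0∞) * (h x + ε) < g n x :=
      fun n hn => Set.mem_iInter.1 hx n n hn le_rfl
    have htop : h x ≠ ∞ := by
      intro htop
      have := hx 1 le_rfl
      simp [htop] at this
    have hfreq : ∃ᶠ n : ℕ in atTop, g n x / n < h x + ε :=
      frequently_lt_of_liminf_lt (by isBoundedDefault) (ENNReal.lt_add_right htop hε.ne')
    obtain ⟨n, hn, hn1⟩ := (hfreq.and_eventually (eventually_ge_atTop 1)).exists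
    have hn0 : (n : ℝ≥0∞) ≠ 0 := by simpa using (by omega : n ≠ 0)
    rw [ENNReal.div_lt_iff (Or.inl hn0) (Or.inl (ENNReal.natCast_ne_top n)), mul_comm] at hn
    exact (hx n hn1).not_gt hn
  have hBlim : Tendsto (fun N => ∫⁻ x in B N, g 1 x ∂μ) atTop (nhds 0) := by
    refine tendsto_setLIntegral_zero hint ?_
    have := tendsto_measure_iInter_atTop (μ := μ) (fun N => (hBm N).nullMeasurableSet) hBanti
      ⟨0, measure_ne_top _ _⟩
    rwa [hBempty, measure_empty] at this
  have key : ∀ N, 1 ≤ N → c ≤ ∫⁻ x, h x ∂μ + ε + ∫⁻ x in B N, g 1 x ∂μ := by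
    intro N hN
    let φ : Ω → ℝ≥0∞ := fun x => (h x + ε) + (B N).indicator (g 1) x
    have hφm : Measurable φ := (hm.add_const _).add ((hg 1).indicator (hBm N))
    have hφint : ∫⁻ x, φ x ∂μ = ∫⁻ x, h x ∂μ + ε + ∫⁻ x in B N, g 1 x ∂μ := by
      simp only [φ]
      rw [lintegral_add_left (hm.add_const _), lintegral_add_left hm, lintegral_indicator (hBm N)]
      simp
    have hφ : ∀ x, ∃ n, 1 ≤ n ∧ n ≤ N ∧ g n x ≤ ∑ i ∈ Finset.range n, φ (T^[i] x) := by
      intro x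
      by_cases hx : x ∈ B N
      · exact ⟨1, le_rfl, hN, by simp [φ, hx]⟩
      · simp only [B, Set.mem_ofPred_eq, not_forall, not_lt] at hx
        obtain ⟨n, h1, h2, h3⟩ := hx
        refine ⟨n, h1, h2, h3.trans ?_⟩
        calc (n : ℝ≥0∞) * (h x + ε) = ∑ i ∈ Finset.range n, (h x + ε) := by
              rw [Finset.sum_const, Finset.card_range, nsmul_eq_mul]
          _ ≤ ∑ i ∈ Finset.range n, φ (T^[i] x) := by
            refine Finset.sum_le_sum fun i _ => le_add_right ?_
            gcongr
            exact hmono i x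
    rw [← hφint]
    refine le_of_forall_natCast_mul_le (b := N * ∫⁻ x, g 1 x ∂μ)
      (ENNReal.mul_ne_top (ENNReal.natCast_ne_top N) hint) fun K => ?_
    exact (hc K).trans (lintegral_apply_le hT hg hφm hsub h0 hφ K)
  have hlim := (tendsto_const_nhds (x := ∫⁻ x, h x ∂μ + ε)).add hBlim
  rw [add_zero] at hlim
  exact ge_of_tendsto hlim ((eventually_ge_atTop 1).mono key)

end Kingman

section RandomProducts

open ProbabilityTheory

variable {S : Type*}

/-- The left shift on sequences. -/
def seqShift (γ : ℕ → S) : ℕ → S := fun i => γ (i + 1)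

theorem seqShift_iterate_apply (k : ℕ) (γ : ℕ → S) (i : ℕ) :
    seqShift^[k] γ i = γ (k + i) := by
  induction k generalizing i with
  | zero => simp
  | succ k ih =>
    rw [Function.iterate_succ_apply', seqShift, ih]
    congr 1
    omega

section Cylinders

variable [MeasurableSpace S] {ν : Measure S} [IsProbabilityMeasure ν] {μ : Measure (ℕ → S)}

theorem eq_infinitePi_of_cylinders
    (hiid : ∀ (n : ℕ) (A : Fin n → Set S), (∀ i, MeasurableSet (A i)) →
      μ {γ | ∀ i : Fin n, γ i ∈ A i} = ∏ i, ν (A i)) :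
    μ = Measure.infinitePi fun _ => ν := by
  classical
  refine Measure.eq_infinitePi _ fun s t ht => ?_
  have hs : ∀ i ∈ s, i < s.sup id + 1 := fun i hi => Nat.lt_succ_of_le (Finset.le_sup (f := id) hi)
  have h := hiid (s.sup id + 1) (fun i => if (i : ℕ) ∈ s then t i else Set.univ)
    fun i => by
      split_ifs
      exacts [ht _, MeasurableSet.univ]
  have hset : {γ : ℕ → S | ∀ i : Fin (s.sup id + 1),
      γ i ∈ (if (i : ℕ) ∈ s then t i else Set.univ)} = (s : Set ℕ).pi t := by
    ext γ
    simp only [Set.mem_ofPred_eq, Set.mem_pi, Finset.mem_coe]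
    constructor
    · intro hγ i hi
      simpa [hi] using hγ ⟨i, hs i hi⟩
    · intro hγ i
      split_ifs with hi
      exacts [hγ i hi, Set.mem_univ _]
  rw [← hset, h, Fin.prod_univ_eq_prod_range (fun i => ν (if i ∈ s then t i else Set.univ))]
  symm
  calc ∏ i ∈ s, ν (t i) = ∏ i ∈ s, ν (if i ∈ s then t i else Set.univ) :=
        Finset.prod_congr rfl fun i hi => by rw [if_pos hi]
    _ = _ := Finset.prod_subset (fun i hi => Finset.mem_range.2 (hs i hi)) fun i _ hi => by
        rw [if_neg hi, measure_univ]

theorem measurable_seqShift : Measurable (seqShift : (ℕ → S) → ℕ → S) :=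
  measurable_pi_lambda _ fun i => measurable_pi_apply (i + 1)

theorem measurePreserving_seqShift :
    MeasurePreserving seqShift (Measure.infinitePi fun _ : ℕ => ν)
      (Measure.infinitePi fun _ : ℕ => ν) := by
  refine ⟨measurable_seqShift, Measure.eq_infinitePi _ fun s t ht => ?_⟩
  rw [Measure.map_apply measurable_seqShift
    (MeasurableSet.pi s.countable_toSet fun i _ => ht i)]
  have hset : seqShift ⁻¹' (s : Set ℕ).pi t =
      ((s.map (addRightEmbedding 1) : Finset ℕ) : Set ℕ).pi fun i => t (i - 1) := by
    ext γ
    simp [seqShift, Set.mem_pi]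
  rw [hset, Measure.infinitePi_pi _ fun i _ => ht _]
  simp

theorem indepFun_of_dependsOn_disjoint [Countable S] [DiscreteMeasurableSpace S] [Nonempty S]
    {X Y : (ℕ → S) → ℝ} {s t : Finset ℕ} (hst : Disjoint s t) (hX : DependsOn X s)
    (hY : DependsOn Y t) :
    IndepFun X Y (Measure.infinitePi fun _ : ℕ => ν) := by
  have hind : iIndepFun (fun (i : ℕ) (γ : ℕ → S) => γ i) (Measure.infinitePi fun _ : ℕ => ν) :=
    iIndepFun_infinitePi (X := fun _ x => x) fun _ => measurable_id
  have h := hind.indepFun_finset s t hst fun i => measurable_pi_apply i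
  obtain ⟨f, hf⟩ := dependsOn_iff_exists_comp.1 hX
  obtain ⟨g, hg⟩ := dependsOn_iff_exists_comp.1 hY
  rw [hf, hg]
  exact h.comp (measurable_of_countable f) (measurable_of_countable g)

end Cylinders

theorem measurable_of_dependsOn [Countable S] [MeasurableSpace S] [DiscreteMeasurableSpace S]
    [Nonempty S] {X : (ℕ → S) → ℝ} {s : Finset ℕ} (hX : DependsOn X s) : Measurable X := by
  obtain ⟨f, hf⟩ := dependsOn_iff_exists_comp.1 hX
  rw [hf]
  exact (measurable_of_countable (α := s → S) f).comp (s.measurable_restrict)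

variable {M : Type*} [Monoid M] (F : S → M)

theorem seqComp_congr {γ γ' : ℕ → S} {n : ℕ} (h : ∀ i < n, γ i = γ' i) :
    seqComp F γ n = seqComp F γ' n := by
  induction n with
  | zero => rfl
  | succ n ih => rw [seqComp, seqComp, h n n.lt_succ_self, ih fun i hi => h i (by omega)]

theorem seqComp_add (γ : ℕ → S) (m n : ℕ) :
    seqComp F γ (m + n) = seqComp F (seqShift^[m] γ) n * seqComp F γ m := by
  induction n with
  | zero => simp [seqComp]
  | succ n ih => rw [← add_assoc, seqComp, ih, seqComp, seqShift_iterate_apply, mul_assoc]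

section Cocycle

variable {a : ℕ → (ℕ → S) → ℝ}

theorem dependsOn_comp_seqShift_iterate (hdep : ∀ n, DependsOn (a n) (Finset.range n))
    (m k : ℕ) : DependsOn (fun γ => a m (seqShift^[k] γ)) (Finset.Ico k (k + m)) := by
  intro γ γ' h
  refine hdep m fun i hi => ?_
  rw [seqShift_iterate_apply, seqShift_iterate_apply]
  refine h _ ?_
  simp only [Finset.coe_range, Set.mem_Iio, Finset.coe_Ico, Set.mem_Ico] at hi ⊢
  omega

theorem cocycle_le_sum_blocks
    (hsub : ∀ m n γ, a (m + n) γ ≤ a m γ + a n (seqShift^[m] γ)) (h0 : ∀ γ, a 0 γ = 0)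
    (m k : ℕ) (γ : ℕ → S) :
    a (m * k) γ ≤ ∑ j ∈ Finset.range k, a m (seqShift^[m * j] γ) := by
  induction k with
  | zero => simp [h0]
  | succ k ih =>
    rw [Finset.sum_range_succ, Nat.mul_succ]
    exact (hsub _ _ _).trans (by gcongr)

theorem cocycle_le_sum_blocks_add
    (hsub : ∀ m n γ, a (m + n) γ ≤ a m γ + a n (seqShift^[m] γ)) (h0 : ∀ γ, a 0 γ = 0)
    (m n : ℕ) (γ : ℕ → S) :
    a n γ ≤ ∑ j ∈ Finset.range (n / m), a m (seqShift^[m * j] γ) +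
      (∑ i ∈ Finset.range n, a 1 (seqShift^[i] γ) -
        ∑ i ∈ Finset.range (m * (n / m)), a 1 (seqShift^[i] γ)) := by
  have hn := Nat.div_add_mod n m
  have h2 := cocycle_le_sum_blocks hsub h0 1 (n % m) (seqShift^[m * (n / m)] γ)
  have h1 := hsub (m * (n / m)) (n % m) γ
  have h3 := cocycle_le_sum_blocks hsub h0 m (n / m) γ
  have h4 := Finset.sum_range_add (fun i => a 1 (seqShift^[i] γ)) (m * (n / m)) (n % m)
  rw [one_mul] at h2
  simp only [one_mul, ← Function.iterate_add_apply] at h2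
  rw [hn] at h1 h4
  simp only [add_comm (m * (n / m))] at h4
  linarith

theorem eventually_cocycle_div_lt
    (hsub : ∀ m n γ, a (m + n) γ ≤ a m γ + a n (seqShift^[m] γ)) (h0 : ∀ γ, a 0 γ = 0)
    {m : ℕ} (hm : 1 ≤ m) {γ : ℕ → S} {A b L : ℝ}
    (hA : Tendsto (fun n : ℕ => (∑ i ∈ Finset.range n, a 1 (seqShift^[i] γ)) / n) atTop (nhds A))
    (hb : Tendsto (fun k : ℕ => (∑ j ∈ Finset.range k, a m (seqShift^[m * j] γ)) / k) atTop
      (nhds b)) (hL : b / m < L) :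
    ∀ᶠ n : ℕ in atTop, a n γ / n < L := by
  have hm0 : (m : ℝ) ≠ 0 := by positivity
  have hdiv : Tendsto (fun n : ℕ => n / m) atTop atTop := Nat.tendsto_div_const_atTop (by omega)
  have hratio : Tendsto (fun n : ℕ => ((n / m : ℕ) : ℝ) / n) atTop (nhds (1 / m)) := by
    have h := (tendsto_nat_floor_mul_div_atTop (R := ℝ) (a := 1 / m) (by positivity)).comp
      tendsto_natCast_atTop_atTop
    refine h.congr fun n => ?_
    simp only [Function.comp]
    rw [← Nat.floor_div_eq_div (K := ℝ) n m]
    congr 3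
    ring
  have hmul : Tendsto (fun n : ℕ => m * (n / m)) atTop atTop :=
    hdiv.const_mul_atTop' (by omega)
  have h1 := (hb.comp hdiv).mul hratio
  have h2 := (hA.comp hmul).mul (hratio.const_mul (m : ℝ))
  have h3 := h1.add (hA.sub h2)
  have hlim : b * (1 / m) + (A - A * (m * (1 / m))) = b / m := by field_simp; ring
  rw [hlim] at h3
  filter_upwards [h3.eventually_lt_const hL, eventually_ge_atTop m] with n hn hnm
  refine lt_of_le_of_lt ?_ hn
  have hn0 : (n : ℝ) ≠ 0 := by
    have : n ≠ 0 := by omega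
    exact_mod_cast this
  have hk0 : ((n / m : ℕ) : ℝ) ≠ 0 := by
    have : n / m ≠ 0 := (Nat.div_pos hnm hm).ne'
    exact_mod_cast this
  have h := div_le_div_of_nonneg_right (cocycle_le_sum_blocks_add hsub h0 m n γ)
    (Nat.cast_nonneg (α := ℝ) n)
  refine h.trans_eq ?_
  simp only [Function.comp]
  push_cast
  field_simp

variable [Countable S] [MeasurableSpace S] [DiscreteMeasurableSpace S]
  {ν : Measure S} [IsProbabilityMeasure ν]

theorem ae_tendsto_sum_blocks [Nonempty S]
    (hdep : ∀ n, DependsOn (a n) (Finset.range n)) (m : ℕ)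
    (hint : Integrable (a m) (Measure.infinitePi fun _ : ℕ => ν)) :
    ∀ᵐ γ ∂(Measure.infinitePi fun _ : ℕ => ν),
      Tendsto (fun k : ℕ => (∑ j ∈ Finset.range k, a m (seqShift^[m * j] γ)) / k) atTop
        (nhds (∫ γ, a m γ ∂(Measure.infinitePi fun _ : ℕ => ν))) := by
  have hT (k : ℕ) := (measurePreserving_seqShift (ν := ν)).iterate k
  have hmeas := measurable_of_dependsOn (hdep m)
  refine strong_law_ae_real (fun j γ => a m (seqShift^[m * j] γ)) hint ?_ ?_
  · intro i j hij
    refine indepFun_of_dependsOn_disjoint ?_ (dependsOn_comp_seqShift_iterate hdep m (m * i))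
      (dependsOn_comp_seqShift_iterate hdep m (m * j))
    rw [Finset.disjoint_left]
    intro x hx hy
    rw [Finset.mem_Ico] at hx hy
    rcases lt_or_gt_of_ne hij with h | h
    · have := Nat.mul_le_mul_left m (Nat.succ_le_of_lt h)
      rw [Nat.mul_succ] at this
      omega
    · have := Nat.mul_le_mul_left m (Nat.succ_le_of_lt h)
      rw [Nat.mul_succ] at this
      omega
  · intro j
    refine ⟨(hmeas.comp (hT _).measurable).aemeasurable, hmeas.aemeasurable, ?_⟩
    change Measure.map (a m ∘ seqShift^[m * j]) _ = Measure.map (a m) _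
    rw [← Measure.map_map hmeas (hT _).measurable, (hT _).map_eq]

/-- Kingman's subadditive ergodic theorem for nonnegative cocycles over the shift on i.i.d.
sequences. -/
theorem ae_tendsto_cocycle_div
    (hdep : ∀ n, DependsOn (a n) (Finset.range n)) (hnonneg : ∀ n γ, 0 ≤ a n γ)
    (hsub : ∀ m n γ, a (m + n) γ ≤ a m γ + a n (seqShift^[m] γ)) (h0 : ∀ γ, a 0 γ = 0)
    (hint : Integrable (a 1) (Measure.infinitePi fun _ : ℕ => ν)) :
    ∀ᵐ γ ∂(Measure.infinitePi fun _ : ℕ => ν), Tendsto (fun n : ℕ => a n γ / n) atTop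
      (nhds (⨅ n : {n : ℕ // 1 ≤ n},
        (∫ γ, a n γ ∂(Measure.infinitePi fun _ : ℕ => ν)) / ((n : ℕ) : ℝ))) := by
  have : Nonempty S := nonempty_of_isProbabilityMeasure ν
  set P : Measure (ℕ → S) := Measure.infinitePi fun _ : ℕ => ν
  have hT : MeasurePreserving seqShift P P := measurePreserving_seqShift
  have hmeas n : Measurable (a n) := measurable_of_dependsOn (hdep n)
  have hintn : ∀ n, Integrable (a n) P := by
    intro n
    have hsum : Integrable (fun γ => ∑ i ∈ Finset.range n, a 1 (seqShift^[i] γ)) P :=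
      integrable_finsetSum _ fun i _ => (hT.iterate i).integrable_comp_of_integrable hint
    refine hsum.mono' (hmeas n).aestronglyMeasurable (Eventually.of_forall fun γ => ?_)
    rw [Real.norm_of_nonneg (hnonneg n γ)]
    simpa using cocycle_le_sum_blocks hsub h0 1 n γ
  set c : {n : ℕ // 1 ≤ n} → ℝ := fun n => (∫ γ, a n γ ∂P) / ((n : ℕ) : ℝ)
  have hc0 : ∀ n, 0 ≤ c n := fun n =>
    div_nonneg (integral_nonneg fun γ => hnonneg n γ) (Nat.cast_nonneg _)
  have hbdd : BddBelow (Set.range c) := ⟨0, by rintro _ ⟨n, rfl⟩; exact hc0 n⟩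
  have : Nonempty {n : ℕ // 1 ≤ n} := ⟨⟨1, le_rfl⟩⟩
  set L : ℝ := ⨅ n, c n
  have hL0 : 0 ≤ L := le_ciInf hc0
  have hupper : ∀ᵐ γ ∂P, ∀ L' > L, ∀ᶠ n : ℕ in atTop, a n γ / n < L' := by
    filter_upwards [ae_all_iff.2 fun m => ae_tendsto_sum_blocks hdep m (hintn m)] with γ hγ L' hL'
    obtain ⟨m, hm⟩ := exists_lt_of_ciInf_lt hL'
    exact eventually_cocycle_div_lt hsub h0 m.2 (by simpa using hγ 1) (hγ m) hm
  let g : ℕ → (ℕ → S) → ENNReal := fun n γ => ENNReal.ofReal (a n γ)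
  have hg : ∀ n, Measurable (g n) := fun n => (hmeas n).ennreal_ofReal
  have hgdiv : ∀ n : ℕ, 1 ≤ n → ∀ γ, g n γ / n = ENNReal.ofReal (a n γ / n) := fun n hn γ => by
    rw [ENNReal.ofReal_div_of_pos (by positivity), ENNReal.ofReal_natCast]
  have hgint : ∀ n, ∫⁻ γ, g n γ ∂P = ENNReal.ofReal (∫ γ, a n γ ∂P) := fun n =>
    (ofReal_integral_eq_lintegral_ofReal (hintn n) (Eventually.of_forall (hnonneg n))).symm
  have hlower : ENNReal.ofReal L ≤ ∫⁻ γ, liminf (fun n => g n γ / n) atTop ∂P := by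
    refine le_lintegral_liminf_div hT hg ?_ ?_ (fun _ => ENNReal.ofReal_ne_top) ?_ ?_
    · intro m n γ
      rw [← ENNReal.ofReal_add (hnonneg _ _) (hnonneg _ _)]
      exact ENNReal.ofReal_le_ofReal (hsub m n γ)
    · simp [g, h0]
    · rw [hgint]; exact ENNReal.ofReal_ne_top
    · intro K
      rcases Nat.eq_zero_or_pos K with rfl | hK
      · simp
      rw [hgint, ← ENNReal.ofReal_natCast, ← ENNReal.ofReal_mul (Nat.cast_nonneg _)]
      refine ENNReal.ofReal_le_ofReal ?_
      have := ciInf_le hbdd ⟨K, hK⟩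
      rw [mul_comm]
      exact (le_div_iff₀ (by positivity)).1 this
  have hle : ∀ᵐ γ ∂P, liminf (fun n => g n γ / n) atTop ≤ ENNReal.ofReal L := by
    filter_upwards [hupper] with γ hγ
    refine ENNReal.le_of_forall_pos_le_add fun ε hε _ => ?_
    refine liminf_le_of_frequently_le' (Eventually.frequently ?_)
    filter_upwards [hγ (L + ε) (by simpa using hε), eventually_ge_atTop 1] with n hn hn1
    rw [hgdiv n hn1]
    refine (ENNReal.ofReal_le_ofReal hn.le).trans_eq ?_
    rw [ENNReal.ofReal_add hL0 (NNReal.coe_nonneg ε), ENNReal.ofReal_coe_nnreal]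
  have hfin : ∫⁻ γ, liminf (fun n => g n γ / n) atTop ∂P ≠ ⊤ :=
    ((lintegral_mono_ae hle).trans_lt (by simp)).ne
  have heq := ae_eq_of_ae_le_of_lintegral_le hle hfin aemeasurable_const (by simpa using hlower)
  filter_upwards [hupper, heq] with γ hγ hγeq
  refine tendsto_order.2 ⟨fun b hb => ?_, fun b hb => hγ b hb⟩
  rcases lt_or_ge b 0 with hb0 | hb0
  · exact Eventually.of_forall fun n => hb0.trans_le (div_nonneg (hnonneg n γ) (Nat.cast_nonneg n))
  have hlt : ENNReal.ofReal b < liminf (fun n => g n γ / n) atTop := by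
    rw [hγeq]
    exact (ENNReal.ofReal_lt_ofReal_iff_of_nonneg hb0).2 hb
  filter_upwards [eventually_lt_of_lt_liminf hlt, eventually_ge_atTop 1] with n hn hn1
  rw [hgdiv n hn1] at hn
  exact (ENNReal.ofReal_lt_ofReal_iff_of_nonneg hb0).1 hn

end Cocycle

end RandomProducts

theorem random_dynamical_degree_exists_ae
    {S M : Type*} [Monoid M] [Countable S] [MeasurableSpace S]
    [DiscreteMeasurableSpace S]
    -- the maps in `S`, as dominant rational self-maps of `ℙ^N(ℚ̄)`:
    (F : S → M) (deg : M → ℕ)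
    (hdominant : ∀ f : M, 1 ≤ deg f)
    (hdeg_id : deg 1 = 1)
    (hdeg_comp : ∀ f g : M, deg (f * g) ≤ deg f * deg g)
    -- `ν` is a probability measure on `S`:
    (ν : Measure S) [IsProbabilityMeasure ν]
    -- `μ = ν̄` is the i.i.d. product measure on `Φ_S = ∏_{i=1}^∞ S`:
    (μ : Measure (ℕ → S)) [IsProbabilityMeasure μ]
    (hiid : ∀ (n : ℕ) (A : Fin n → Set S),
      μ {γ | ∀ i : Fin n, γ i ∈ A i} = ∏ i, ν (A i))
    -- `E_1[log deg φ]` exists: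
    (hint : Integrable (fun s => Real.log (deg (F s))) ν) :
    -- for ν̄-a.e. `γ`, `lim_n deg(γ_n)^{1/n}` exists and equals
    -- `δ_{S,ν} = exp(inf_{n ≥ 1} E_n[log deg γ_n]/n)`:
    ∀ᵐ γ ∂μ, Tendsto (fun n : ℕ => (deg (seqComp F γ n) : ℝ) ^ ((n : ℝ)⁻¹))
      atTop
      (nhds (Real.exp (⨅ n : {n : ℕ // 1 ≤ n},
        (∫ γ, Real.log (deg (seqComp F γ (n : ℕ))) ∂μ) / ((n : ℕ) : ℝ)))) := by
  have hμ : μ = Measure.infinitePi fun _ => ν :=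
    eq_infinitePi_of_cylinders fun n A _ => hiid n A
  subst hμ
  have hpos : ∀ f : M, (0 : ℝ) < deg f := fun f => by exact_mod_cast hdominant f
  let a : ℕ → (ℕ → S) → ℝ := fun n γ => Real.log (deg (seqComp F γ n))
  have hdep : ∀ n, DependsOn (a n) (Finset.range n) := fun n γ γ' h => by
    simp only [a]
    rw [seqComp_congr F fun i hi => h i (by simpa using hi)]
  have hsub : ∀ m n γ, a (m + n) γ ≤ a m γ + a n (seqShift^[m] γ) := fun m n γ => by
    simp only [a]
    rw [← Real.log_mul (hpos _).ne' (hpos _).ne', seqComp_add, mul_comm (deg _ : ℝ)]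
    exact Real.log_le_log (hpos _) (by exact_mod_cast hdeg_comp _ _)
  have hint1 : Integrable (a 1) (Measure.infinitePi fun _ : ℕ => ν) := by
    simpa [a, seqComp, Function.comp_def] using
      (measurePreserving_eval_infinitePi (fun _ : ℕ => ν) 0).integrable_comp_of_integrable hint
  filter_upwards [ae_tendsto_cocycle_div hdep
    (fun n γ => Real.log_nonneg (by exact_mod_cast hdominant _)) hsub
    (fun γ => by simp [a, seqComp, hdeg_id]) hint1] with γ hγ
  refine ((Real.continuous_exp.tendsto _).comp hγ).congr fun n => ?_
  rw [Real.rpow_def_of_pos (hpos _), ← div_eq_mul_inv]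
  rfl
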